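/- arXiv:1402.4492 — 6 statements merged into one kernel-verified Lean document; each statement's English description precedes it below -/
import Mathlib

section
/- Let K > 0 and let X_1, X_2 be independent random variables, each uniformly distributed on the interval [−1/(2K), 1/(2K)]. Then the density of the random variable (X_1 + X_2)/√2 equals √2 · K at the origin (so the bound √2·K on the density of normalized sums of independent variables with densities bounded by K is attained). -/
open MeasureTheory ProbabilityTheory

open scoped ENNReal

lemma cond_volume_Icc_eq_withDensity {K : ℝ} (hK : 0 < K) :
    ProbabilityTheory.cond volume (Set.Icc (-(1 / (2 * K))) (1 / (2 * K))) =
      volume.withDensity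
        ((Set.Icc (-(1 / (2 * K))) (1 / (2 * K))).indicator fun _ => ENNReal.ofReal K) := by
  have hlen : 1 / (2 * K) - -(1 / (2 * K)) = K⁻¹ := by field_simp; norm_num
  rw [withDensity_indicator measurableSet_Icc, withDensity_const, ProbabilityTheory.cond,
    Real.volume_Icc, hlen, ENNReal.ofReal_inv_of_pos hK, inv_inv]

lemma lconvolution_indicator_Icc (c : ℝ≥0∞) (a : ℝ) :
    lconvolution ((Set.Icc (-a) a).indicator fun _ => c)
        ((Set.Icc (-a) a).indicator fun _ => c) volume =
      fun x => c * c * ENNReal.ofReal (2 * a - |x|) := by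
  funext x
  have hprod : ∀ y, (Set.Icc (-a) a).indicator (fun _ => c) y *
      (Set.Icc (-a) a).indicator (fun _ => c) (-y + x) =
      (Set.Icc (max (-a) (x - a)) (min a (x + a))).indicator (fun _ => c * c) y := by
    intro y
    have hmem : y ∈ Set.Icc (max (-a) (x - a)) (min a (x + a)) ↔
        y ∈ Set.Icc (-a) a ∧ -y + x ∈ Set.Icc (-a) a := by
      simp only [Set.mem_Icc, max_le_iff, le_min_iff]
      constructor <;> rintro ⟨⟨_, _⟩, _, _⟩ <;> refine ⟨⟨?_, ?_⟩, ?_, ?_⟩ <;> linarith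
    by_cases h₁ : y ∈ Set.Icc (-a) a <;> by_cases h₂ : -y + x ∈ Set.Icc (-a) a <;>
      simp only [Set.indicator, hmem, h₁, h₂, and_self, and_true, and_false, if_true, if_false,
        mul_zero, zero_mul]
  have hlen : min a (x + a) - max (-a) (x - a) = 2 * a - |x| := by
    rcases le_total 0 x with hx | hx
    · rw [abs_of_nonneg hx, min_eq_left (by linarith), max_eq_right (by linarith)]; ring
    · rw [abs_of_nonpos hx, min_eq_right (by linarith), max_eq_left (by linarith)]; ring
  simp_rw [lconvolution_def, hprod]
  rw [lintegral_indicator_const measurableSet_Icc, Real.volume_Icc, hlen]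

lemma map_div_withDensity {c : ℝ} (hc : 0 < c) {h : ℝ → ℝ≥0∞} (hh : Measurable h) :
    (volume.withDensity h).map (· / c) =
      volume.withDensity fun x => ENNReal.ofReal c * h (c * x) := by
  ext s hs
  have hdiv : Measurable fun x : ℝ => x / c := by fun_prop
  rw [Measure.map_apply hdiv hs, withDensity_apply _ (hdiv hs), withDensity_apply _ hs,
    ← Real.smul_map_volume_mul_left hc.ne', Measure.restrict_smul, lintegral_smul_measure,
    setLIntegral_map (hdiv hs) hh (by fun_prop), Real.smul_map_volume_mul_left hc.ne',
    lintegral_const_mul _ (by fun_prop), abs_of_pos hc, smul_eq_mul]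
  congr 3
  ext x
  simp [mul_div_cancel_left₀ x hc.ne']

/-- **Optimality of the constant √2.** If `X₁, X₂` are independent and uniformly distributed on
`[-1/(2K), 1/(2K)]` (so each has density bounded by `K`), then the (continuous) density of
`(X₁ + X₂)/√2` takes the value `√2 · K` at the origin. -/
theorem density_of_normalized_sum_of_uniforms_at_zero :
    ∀ (Ω : Type) [MeasureSpace Ω], ∀ (_ : IsProbabilityMeasure (ℙ : Measure Ω))
      (K : ℝ), 0 < K →
      ∀ (X₁ X₂ : Ω → ℝ), Measurable X₁ → Measurable X₂ → IndepFun X₁ X₂ ℙ →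
      pdf.IsUniform X₁ (Set.Icc (-(1 / (2 * K))) (1 / (2 * K))) ℙ volume →
      pdf.IsUniform X₂ (Set.Icc (-(1 / (2 * K))) (1 / (2 * K))) ℙ volume →
      ∃ f : ℝ → ℝ, Continuous f ∧ (∀ x, 0 ≤ f x) ∧
        Measure.map (fun ω => (X₁ ω + X₂ ω) / Real.sqrt 2) ℙ
          = volume.withDensity (fun x => ENNReal.ofReal (f x)) ∧
        f 0 = Real.sqrt 2 * K := by
  intro Ω _ _ K hK X₁ X₂ hX₁ hX₂ hind hU₁ hU₂
  have h2 : 0 < Real.sqrt 2 := by positivity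
  refine ⟨fun x => Real.sqrt 2 * (K * K * max 0 (K⁻¹ - |Real.sqrt 2 * x|)), by fun_prop,
    fun x => by positivity, ?_, by simp [hK.le]⟩
  have hsum : Measure.map (X₁ + X₂) ℙ = volume.withDensity fun x =>
      ENNReal.ofReal K * ENNReal.ofReal K * ENNReal.ofReal (2 * (1 / (2 * K)) - |x|) := by
    rw [hind.map_add_eq_map_conv_map hX₁ hX₂, show Measure.map X₁ ℙ = _ from hU₁,
      show Measure.map X₂ ℙ = _ from hU₂, cond_volume_Icc_eq_withDensity hK,
      conv_withDensity_eq_lconvolution (measurable_const.indicator measurableSet_Icc)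
        (measurable_const.indicator measurableSet_Icc), lconvolution_indicator_Icc]
  have hcomp : (fun ω => (X₁ ω + X₂ ω) / Real.sqrt 2) = (· / Real.sqrt 2) ∘ (X₁ + X₂) := rfl
  rw [hcomp, ← Measure.map_map (by fun_prop) (hX₁.add hX₂), hsum,
    map_div_withDensity h2 (by fun_prop)]
  congr 1
  funext x
  have hK2 : 2 * (1 / (2 * K)) = K⁻¹ := by field_simp
  rw [hK2, ENNReal.ofReal_mul h2.le, ENNReal.ofReal_mul (by positivity),
    ENNReal.ofReal_mul hK.le, max_comm, ENNReal.ofReal_max, ENNReal.ofReal_zero, max_zero]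
end

section
/- Let Z be a random vector taking values in a d-dimensional subspace of ℝ^n. Then for every M ≥ 1 and every t ≥ 0, 𝓛(Z, t) ≤ 𝓛(Z, M·t) ≤ (3M)^d · 𝓛(Z, t). -/
open MeasureTheory ProbabilityTheory

/-- The Lévy concentration function of a random vector `Z` with values in a normed
space: `𝓛(Z, t) = sup_u ℙ(‖Z - u‖ ≤ t)`. -/
noncomputable def levyConc {Ω E : Type*} [MeasurableSpace Ω] [NormedAddCommGroup E]
    (μ : Measure Ω) (Z : Ω → E) (t : ℝ) : ENNReal :=
  ⨆ u : E, μ {ω | ‖Z ω - u‖ ≤ t}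

open Metric Module in
open scoped Function ENNReal in
/-- Volumetric bound on the size of a `t`-separated set in a ball of radius `r`. -/
theorem card_le_of_pairwise_lt_dist {E : Type*} [NormedAddCommGroup E] [NormedSpace ℝ E]
    [FiniteDimensional ℝ E] {t r : ℝ} (ht : 0 < t) (hr : 0 ≤ r) (x : E) (s : Finset E)
    (hs : ∀ c ∈ s, dist c x ≤ r) (h : (s : Set E).Pairwise (t < dist · ·)) :
    (s.card : ℝ) ≤ (2 * (r / t) + 1) ^ finrank ℝ E := by
  borelize E
  let μ : Measure E := Measure.addHaar
  have hδ : 0 < t / 2 := by positivity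
  have hρ : 0 < r + t / 2 := by positivity
  have disjoint_balls : (s : Set E).Pairwise (Disjoint on fun c => ball c (t / 2)) := by
    intro c hc d hd hcd
    apply ball_disjoint_ball
    linarith [h hc hd hcd]
  have balls_subset : ⋃ c ∈ s, ball c (t / 2) ⊆ ball x (r + t / 2) :=
    Set.iUnion₂_subset fun c hc => ball_subset_ball' (by linarith [hs c hc])
  have volume_le : (s.card : ℝ≥0∞) * ENNReal.ofReal ((t / 2) ^ finrank ℝ E) * μ (ball 0 1) ≤
      ENNReal.ofReal ((r + t / 2) ^ finrank ℝ E) * μ (ball 0 1) :=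
    calc
      _ = μ (⋃ c ∈ s, ball c (t / 2)) := by
        rw [measure_biUnion_finset disjoint_balls fun c _ => measurableSet_ball]
        simp only [μ.addHaar_ball_of_pos _ hδ, Finset.sum_const, nsmul_eq_mul, mul_assoc]
      _ ≤ μ (ball x (r + t / 2)) := measure_mono balls_subset
      _ = _ := μ.addHaar_ball_of_pos _ hρ
  have card_mul_le : (s.card : ℝ≥0∞) * ENNReal.ofReal ((t / 2) ^ finrank ℝ E) ≤
      ENNReal.ofReal ((r + t / 2) ^ finrank ℝ E) :=
    (ENNReal.mul_le_mul_iff_left (measure_ball_pos _ _ zero_lt_one).ne'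
      measure_ball_lt_top.ne).1 volume_le
  have card_mul_le_real : (s.card : ℝ) * (t / 2) ^ finrank ℝ E ≤ (r + t / 2) ^ finrank ℝ E := by
    have := ENNReal.toReal_le_of_le_ofReal (pow_nonneg hρ.le _) card_mul_le
    rwa [ENNReal.toReal_mul, ENNReal.toReal_natCast,
      ENNReal.toReal_ofReal (pow_nonneg hδ.le _)] at this
  rw [show 2 * (r / t) + 1 = (r + t / 2) / (t / 2) by field_simp, div_pow]
  exact (le_div_iff₀ (pow_pos hδ _)).2 card_mul_le_real

open Metric Module in
/-- A ball of radius `r` in a `d`-dimensional normed space is covered by at most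
`(2 r / t + 1) ^ d` balls of radius `t`. -/
theorem exists_finset_card_le_closedBall_subset {E : Type*} [NormedAddCommGroup E]
    [NormedSpace ℝ E] [FiniteDimensional ℝ E] {t r : ℝ} (ht : 0 < t) (hr : 0 ≤ r) (x : E) :
    ∃ s : Finset E, (s.card : ℝ) ≤ (2 * (r / t) + 1) ^ finrank ℝ E ∧
      closedBall x r ⊆ ⋃ c ∈ s, closedBall c t := by
  classical
  let P : ℕ → Prop := fun k => ∃ s : Finset E, s.card = k ∧ (∀ c ∈ s, dist c x ≤ r) ∧
    (s : Set E).Pairwise (t < dist · ·)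
  let N : ℕ := ⌊(2 * (r / t) + 1) ^ finrank ℝ E⌋₊
  have card_le_of_P : ∀ k, P k → k ≤ N := by
    rintro _ ⟨s, rfl, hs, h⟩
    exact Nat.le_floor (card_le_of_pairwise_lt_dist ht hr x s hs h)
  obtain ⟨s, hcard, hs, hsep⟩ : P (Nat.findGreatest P N) :=
    Nat.findGreatest_spec (Nat.zero_le N) ⟨∅, by simp⟩
  refine ⟨s, card_le_of_pairwise_lt_dist ht hr x s hs hsep, fun y hy => ?_⟩
  by_contra hcover
  simp only [Set.mem_iUnion, mem_closedBall, not_exists, not_le] at hcover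
  have hys : y ∉ s := fun hy' => (hcover y hy').not_ge (by simpa using ht.le)
  have hinsert : P (s.card + 1) := by
    refine ⟨insert y s, Finset.card_insert_of_notMem hys, ?_, ?_⟩
    · simpa [Finset.forall_mem_insert] using ⟨hy, hs⟩
    · rw [Finset.coe_insert]
      refine hsep.insert fun c hc _ => ⟨hcover c hc, ?_⟩
      rw [dist_comm]
      exact hcover c hc
  have := Nat.le_findGreatest (card_le_of_P _ hinsert) hinsert
  lia

theorem levyConc_mono {Ω E : Type*} [MeasurableSpace Ω] [NormedAddCommGroup E]
    (μ : Measure Ω) (Z : Ω → E) : Monotone (levyConc μ Z) :=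
  fun _ _ h => iSup_mono fun _ => measure_mono fun _ hω => le_trans hω h

theorem measure_le_card_mul_levyConc {Ω E : Type*} [MeasurableSpace Ω] [NormedAddCommGroup E]
    (μ : Measure Ω) (Z : Ω → E) (t : ℝ) (s : Finset E) {A : Set Ω}
    (hA : ∀ ω ∈ A, ∃ c ∈ s, ‖Z ω - c‖ ≤ t) : μ A ≤ s.card * levyConc μ Z t :=
  calc
    μ A ≤ μ (⋃ c ∈ s, {ω | ‖Z ω - c‖ ≤ t}) :=
      measure_mono fun ω hω => by simpa using hA ω hω
    _ ≤ ∑ c ∈ s, μ {ω | ‖Z ω - c‖ ≤ t} := measure_biUnion_finset_le _ _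
    _ ≤ ∑ _c ∈ s, levyConc μ Z t :=
      Finset.sum_le_sum fun c _ => le_iSup (fun u => μ {ω | ‖Z ω - u‖ ≤ t}) c
    _ = s.card * levyConc μ Z t := by simp

open Module in
theorem levyConc_mul_le {Ω F : Type*} [MeasurableSpace Ω] [NormedAddCommGroup F]
    [InnerProductSpace ℝ F] (μ : Measure Ω) (Z : Ω → F) (E : Submodule ℝ F)
    [FiniteDimensional ℝ E] (hZ : ∀ ω, Z ω ∈ E) {M t : ℝ} (hM : 1 ≤ M) (ht : 0 < t) :
    levyConc μ Z (M * t) ≤ ENNReal.ofReal ((3 * M) ^ finrank ℝ E) * levyConc μ Z t := by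
  classical
  refine iSup_le fun u => ?_
  obtain ⟨s, hcard, hcover⟩ := exists_finset_card_le_closedBall_subset ht
    (show 0 ≤ M * t by positivity) (E.orthogonalProjectionOnto u)
  have hcard' : ((s.image ((↑) : E → F)).card : ℝ) ≤ (3 * M) ^ finrank ℝ E :=
    calc
      ((s.image ((↑) : E → F)).card : ℝ) ≤ s.card := mod_cast Finset.card_image_le
      _ ≤ (2 * M + 1) ^ finrank ℝ E := by rwa [mul_div_cancel_right₀ _ ht.ne'] at hcard
      _ ≤ (3 * M) ^ finrank ℝ E := by gcongr; linarith
  refine (measure_le_card_mul_levyConc μ Z t (s.image (↑)) fun ω hω => ?_).trans ?_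
  · have hproj : dist (⟨Z ω, hZ ω⟩ : E) (E.orthogonalProjectionOnto u) ≤ M * t := by
      rw [← E.orthogonalProjectionOnto_mem_subspace_eq_self ⟨Z ω, hZ ω⟩, dist_eq_norm, ← map_sub]
      exact (E.norm_orthogonalProjectionOnto_apply_le _).trans hω
    obtain ⟨c, hc, hdist⟩ : ∃ c ∈ s, dist (⟨Z ω, hZ ω⟩ : E) c ≤ t := by
      simpa using hcover hproj
    exact ⟨c, Finset.mem_image_of_mem _ hc, by simpa [dist_eq_norm, Subtype.dist_eq] using hdist⟩
  · gcongr
    rw [← ENNReal.ofReal_natCast]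
    exact ENNReal.ofReal_le_ofReal hcard'


/-- **Regularity of the concentration function.** If `Z` takes values in a `d`-dimensional
subspace of `ℝ^n`, then for `M ≥ 1`, `𝓛(Z, t) ≤ 𝓛(Z, Mt) ≤ (3M)^d · 𝓛(Z, t)`. -/
theorem levyConc_regularity :
    ∀ (Ω : Type) [MeasureSpace Ω], ∀ (_ : IsProbabilityMeasure (ℙ : Measure Ω))
      (n d : ℕ) (Z : Ω → EuclideanSpace ℝ (Fin n))
      (E : Submodule ℝ (EuclideanSpace ℝ (Fin n))), Module.finrank ℝ E = d →
      (∀ ω, Z ω ∈ E) →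
      ∀ (M t : ℝ), 1 ≤ M → 0 ≤ t →
      levyConc ℙ Z t ≤ levyConc ℙ Z (M * t) ∧
      levyConc ℙ Z (M * t) ≤ ENNReal.ofReal ((3 * M) ^ d) * levyConc ℙ Z t := by
  rintro Ω _ _ n d Z E rfl hZ M t hM ht
  refine ⟨levyConc_mono _ _ (le_mul_of_one_le_left ht hM), ?_⟩
  rcases ht.eq_or_lt with rfl | ht
  · rw [mul_zero]
    exact le_mul_of_one_le_left' (ENNReal.one_le_ofReal.2 (one_le_pow₀ (by linarith)))
  · exact levyConc_mul_le _ Z E hZ hM ht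
end

section
/- Let Z be a random vector taking values in a d-dimensional subspace E of ℝ^n, and suppose that for some M ≥ 0 one has 𝓛(Z, t·√d) ≤ (M·t)^d for all t ≥ 0. Then the law of Z on E is absolutely continuous with respect to d-dimensional Lebesgue measure on E, with density bounded by M^d almost everywhere. -/
open MeasureTheory ProbabilityTheory

/-- A measure `ν` is absolutely continuous with respect to `μ` with density bounded by `K`
almost everywhere. -/
def HasDensityLE {E : Type*} [MeasurableSpace E] (ν μ : Measure E) (K : ℝ) : Prop :=
  ∃ f : E → ENNReal, ν = μ.withDensity f ∧ ∀ᵐ x ∂μ, f x ≤ ENNReal.ofReal K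

/-- The closed ball of radius `√d` in a `d`-dimensional Euclidean space contains a unit cube. -/
lemma one_le_volume_closedBall_sqrt_finrank (E : Type*) [NormedAddCommGroup E]
    [InnerProductSpace ℝ E] [FiniteDimensional ℝ E] [MeasurableSpace E] [BorelSpace E] :
    1 ≤ (volume : Measure E) (Metric.closedBall 0 (√(Module.finrank ℝ E))) := by
  rw [← (stdOrthonormalBasis ℝ E).volume_parallelepiped]
  refine measure_mono fun x hx => ?_
  obtain ⟨t, ht, rfl⟩ := (mem_parallelepiped_iff _ _).1 hx
  rw [mem_closedBall_zero_iff]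
  refine Real.le_sqrt_of_sq_le ?_
  rw [← real_inner_self_eq_norm_sq, (stdOrthonormalBasis ℝ E).orthonormal.inner_sum]
  calc ∑ i, t i * t i ≤ ∑ i : Fin (Module.finrank ℝ E), (1 : ℝ) :=
        Finset.sum_le_sum fun i _ => mul_le_one₀ (ht.2 i) (ht.1 i) (ht.2 i)
    _ = Module.finrank ℝ E := by simp

/-- A finite measure dominated by `ν` on all closed balls of positive radius is dominated
by `ν`. -/
lemma measure_le_of_forall_closedBall_le {E : Type*} [NormedAddCommGroup E] [NormedSpace ℝ E]
    [FiniteDimensional ℝ E] [MeasurableSpace E] [BorelSpace E] (ρ ν : Measure E)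
    [IsFiniteMeasure ρ] [IsLocallyFiniteMeasure ν]
    (h : ∀ x : E, ∀ r > 0, ρ (Metric.closedBall x r) ≤ ν (Metric.closedBall x r)) : ρ ≤ ν := by
  have : ProperSpace E := FiniteDimensional.proper ℝ E
  refine Measure.le_iff'.2 fun s => (Besicovitch.vitaliFamily ρ).measure_le_of_frequently_le ν
    Measure.AbsolutelyContinuous.rfl s fun x _ =>
      (Besicovitch.tendsto_filterAt ρ x).frequently (Filter.Eventually.frequently ?_)
  filter_upwards [self_mem_nhdsWithin] with r hr using h x r hr

lemma hasDensityLE_of_le_smul {E : Type*} [MeasurableSpace E] {ν μ : Measure E} [SigmaFinite μ]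
    [IsFiniteMeasure ν] {K : ℝ} (h : ν ≤ ENNReal.ofReal K • μ) : HasDensityLE ν μ K := by
  have hac : ν ≪ μ := (Measure.absolutelyContinuous_of_le h).trans
    Measure.smul_absolutelyContinuous
  refine ⟨ν.rnDeriv μ, (Measure.withDensity_rnDeriv_eq ν μ hac).symm, ?_⟩
  refine ae_le_of_forall_setLIntegral_le_of_sigmaFinite (Measure.measurable_rnDeriv ν μ)
    fun s _ _ => ?_
  rw [Measure.setLIntegral_rnDeriv hac, setLIntegral_const]
  exact h s

/-- If `Z` takes values in a `d`-dimensional subspace `E` of `ℝ^n` and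
`𝓛(Z, t√d) ≤ (M·t)^d` for all `t ≥ 0`, then the law of `Z` on `E` is absolutely continuous
with respect to the `d`-dimensional Lebesgue measure on `E`, with density bounded by `M^d`. -/
theorem density_le_of_levyConc_le :
    ∀ (Ω : Type) [MeasureSpace Ω], ∀ (_ : IsProbabilityMeasure (ℙ : Measure Ω))
      (n d : ℕ) (E : Submodule ℝ (EuclideanSpace ℝ (Fin n))), Module.finrank ℝ E = d →
      ∀ (M : ℝ), 0 ≤ M →
      ∀ (Z : Ω → E), Measurable Z →
      (∀ t : ℝ, 0 ≤ t → levyConc ℙ Z (t * Real.sqrt d) ≤ ENNReal.ofReal ((M * t) ^ d)) →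
      HasDensityLE (Measure.map Z ℙ) (volume : Measure E) (M ^ d) := by
  intro Ω _ _ n d E hd M hM Z hZ h
  have : IsProbabilityMeasure (Measure.map Z ℙ) := Measure.isProbabilityMeasure_map hZ.aemeasurable
  have : IsLocallyFiniteMeasure (ENNReal.ofReal (M ^ d) • (volume : Measure E)) :=
    isLocallyFiniteMeasureSMulNNReal volume (M ^ d).toNNReal
  refine hasDensityLE_of_le_smul (measure_le_of_forall_closedBall_le _ _ fun x r hr => ?_)
  have key : ∀ t : ℝ, 0 ≤ t → Measure.map Z ℙ (Metric.closedBall x (t * √d)) ≤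
      ENNReal.ofReal (M ^ d) * volume (Metric.closedBall x (t * √d)) := fun t ht =>
    calc Measure.map Z ℙ (Metric.closedBall x (t * √d))
        = ℙ {ω | ‖Z ω - x‖ ≤ t * √d} := by
          rw [Measure.map_apply hZ Metric.isClosed_closedBall.measurableSet]
          simp only [Set.preimage, mem_closedBall_iff_norm]
      _ ≤ ENNReal.ofReal ((M * t) ^ d) :=
          (le_iSup (fun u : E => ℙ {ω | ‖Z ω - u‖ ≤ t * √d}) x).trans (h t ht)
      _ = ENNReal.ofReal (M ^ d) * (ENNReal.ofReal (t ^ d) * 1) := by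
          rw [mul_one, mul_pow, ENNReal.ofReal_mul (by positivity)]
      _ ≤ ENNReal.ofReal (M ^ d) *
            (ENNReal.ofReal (t ^ d) * volume (Metric.closedBall (0 : E) (√d))) := by
          gcongr
          simpa only [hd] using one_le_volume_closedBall_sqrt_finrank E
      _ = _ := by
        rw [Measure.addHaar_closedBall_mul _ _ ht (Real.sqrt_nonneg _), hd]
  rcases Nat.eq_zero_or_pos d with rfl | hpos
  · have := Module.finrank_zero_iff.1 hd
    have hball : Metric.closedBall x r = Metric.closedBall x (0 * √(0 : ℕ)) :=
      Set.ext fun y => by simp [Subsingleton.elim y x, hr.le]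
    rw [hball]
    exact key 0 le_rfl
  · have hd' : √(d : ℝ) ≠ 0 := by positivity
    simpa only [div_mul_cancel₀ r hd', Measure.smul_apply, smul_eq_mul] using
      key (r / √d) (by positivity)
end

section
/- There exists an absolute constant c > 0 such that the following holds. Let X be a real-valued random variable with density bounded by K almost everywhere, and let φ_X(t) = E[e^{itX}] be its characteristic function. Then: (a) for every t with 0 < t < 2πK, the Lebesgue measure of the set {τ ∈ ℝ : |φ_X(τ)| > 1 − c·(t/K)²} is at most t; and (b) for every t ≥ 2πK, the Lebesgue measure of the set {τ ∈ ℝ : |φ_X(τ)| > √(2πK/t)} is at most t. (Equivalently, the non-increasing rearrangement of |φ_X| satisfies |φ_X|*(t) ≤ 1 − c(t/K)² for 0 < t < 2πK and |φ_X|*(t) ≤ √(2πK/t) for t ≥ 2πK.) -/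
open MeasureTheory ProbabilityTheory

/-- The characteristic function `φ_X(t) = E[exp(itX)]` of a real random variable. -/
noncomputable def charFun {Ω : Type*} [MeasurableSpace Ω] (μ : Measure Ω) (X : Ω → ℝ)
    (t : ℝ) : ℂ :=
  ∫ ω, Complex.exp (Complex.I * t * X ω) ∂μ

open Pointwise in
/-- One-dimensional Brunn-Minkowski inequality for a compact set added to itself. -/
lemma two_mul_volume_le_volume_add_self {s : Set ℝ} (hs : IsCompact s) :
    2 * volume s ≤ volume (s + s) := by
  rcases s.eq_empty_or_nonempty with rfl | hne
  · simp
  obtain ⟨a, ha, hamin⟩ := hs.exists_isLeast hne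
  obtain ⟨b, hb, hbmax⟩ := hs.exists_isGreatest hne
  have hsub : (a +ᵥ s) ∪ (b +ᵥ s) ⊆ s + s := by
    rintro _ (⟨x, hx, rfl⟩ | ⟨x, hx, rfl⟩)
    · exact Set.add_mem_add ha hx
    · exact Set.add_mem_add hb hx
  have hdisj : AEDisjoint volume (a +ᵥ s) (b +ᵥ s) := by
    refine measure_mono_null (t := {a + b}) ?_ (by simp)
    rintro _ ⟨⟨x, hx, rfl⟩, y, hy, hxy⟩
    have h1 : x ≤ b := hbmax hx
    have h2 : a ≤ y := hamin hy
    simp only [vadd_eq_add] at hxy ⊢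
    rw [Set.mem_singleton_iff]
    linarith
  calc 2 * volume s = volume ((a +ᵥ s) ∪ (b +ᵥ s)) := by
        rw [measure_union₀ (hs.vadd b).measurableSet.nullMeasurableSet hdisj, measure_vadd,
          measure_vadd, two_mul]
    _ ≤ volume (s + s) := measure_mono hsub

lemma conv_le_smul_volume {ν ρ : Measure ℝ} [SFinite ν] [IsProbabilityMeasure ρ] {c : ENNReal}
    (h : ν ≤ c • volume) : ν ∗ ρ ≤ c • volume := by
  refine Measure.le_iff.2 fun s hs => ?_
  have hm : Measurable fun p : ℝ × ℝ => p.1 + p.2 := by fun_prop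
  rw [Measure.conv, Measure.map_apply hm hs, Measure.prod_apply_symm (hm hs)]
  calc ∫⁻ y, ν ((fun x => (x, y)) ⁻¹' ((fun p : ℝ × ℝ => p.1 + p.2) ⁻¹' s)) ∂ρ
      ≤ ∫⁻ _, (c • volume : Measure ℝ) s ∂ρ := by
        refine lintegral_mono fun y => (h _).trans_eq ?_
        simp only [Measure.smul_apply]
        congr 1
        exact measure_preimage_add_right volume y s
    _ = (c • volume : Measure ℝ) s := by simp

lemma integral_charFun_comm (μ ν : Measure ℝ) [IsFiniteMeasure μ] [IsFiniteMeasure ν] :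
    ∫ t, MeasureTheory.charFun μ t ∂ν = ∫ x, MeasureTheory.charFun ν x ∂μ := by
  simp_rw [charFun_apply_real]
  rw [integral_integral_swap]
  · simp_rw [mul_comm]
  · refine (integrable_const (1 : ℝ)).mono' (by fun_prop) (ae_of_all _ fun p => ?_)
    simp only [Function.uncurry]
    rw [← Complex.ofReal_mul, Complex.norm_exp_ofReal_mul_I]

lemma charFun_conv_map_neg (ν : Measure ℝ) [IsFiniteMeasure ν] (t : ℝ) :
    MeasureTheory.charFun (ν ∗ ν.map (fun x => -x)) t
      = ((‖MeasureTheory.charFun ν t‖ ^ 2 : ℝ) : ℂ) := by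
  have h : MeasureTheory.charFun (ν.map fun x => -x) t
      = (starRingEnd ℂ) (MeasureTheory.charFun ν t) := by
    have := charFun_map_mul (μ := ν) (-1) t
    simp only [neg_mul, one_mul, charFun_neg] at this
    exact this
  rw [charFun_conv, h, Complex.mul_conj']
  push_cast
  rfl

open scoped NNReal in
lemma lintegral_exp_mul_enorm_charFun_sq_le {ν : Measure ℝ} [IsProbabilityMeasure ν] {K : ℝ}
    (h : ν ≤ ENNReal.ofReal K • volume) {v : ℝ≥0} (hv : 0 < v) :
    ∫⁻ t, ENNReal.ofReal (Real.exp (-t ^ 2 / (2 * v))) * ‖MeasureTheory.charFun ν t‖ₑ ^ 2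
      ≤ ENNReal.ofReal (2 * Real.pi * K) := by
  have : IsProbabilityMeasure (ν.map fun x => -x) :=
    Measure.isProbabilityMeasure_map (by fun_prop)
  set ρ : Measure ℝ := ν ∗ ν.map (fun x => -x) with hρ
  have hv' : (0 : ℝ) < v := hv
  have hpi := Real.pi_pos
  have hcont : Continuous (MeasureTheory.charFun ν) := continuous_charFun
  have hint : Integrable (fun t => ‖MeasureTheory.charFun ν t‖ ^ 2) (gaussianReal 0 v) := by
    refine (integrable_const (1 : ℝ)).mono' (by fun_prop) (ae_of_all _ fun t => ?_)
    rw [norm_pow, norm_norm]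
    exact pow_le_one₀ (norm_nonneg _) (norm_charFun_le_one t)
  have hparseval : ∫ t, ‖MeasureTheory.charFun ν t‖ ^ 2 ∂(gaussianReal 0 v)
      = ∫ x, Real.exp (-(v / 2) * x ^ 2) ∂ρ := by
    have := integral_charFun_comm ρ (gaussianReal 0 v)
    simp_rw [hρ, charFun_conv_map_neg, charFun_gaussianReal] at this
    rw [integral_complex_ofReal, ← hρ] at this
    apply Complex.ofReal_injective
    refine this.trans ?_
    rw [← integral_complex_ofReal]
    refine integral_congr_ae (ae_of_all _ fun x => ?_)
    push_cast
    ring_nf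
  have hgauss : ∫⁻ t, ‖MeasureTheory.charFun ν t‖ₑ ^ 2 ∂(gaussianReal 0 v)
      ≤ ENNReal.ofReal K * ENNReal.ofReal √(Real.pi / (v / 2)) := by
    calc ∫⁻ t, ‖MeasureTheory.charFun ν t‖ₑ ^ 2 ∂(gaussianReal 0 v)
        = ∫⁻ t, ENNReal.ofReal (‖MeasureTheory.charFun ν t‖ ^ 2) ∂(gaussianReal 0 v) := by
          simp_rw [ENNReal.ofReal_pow (norm_nonneg _), ofReal_norm]
      _ = ENNReal.ofReal (∫ x, Real.exp (-(v / 2) * x ^ 2) ∂ρ) := by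
          rw [← hparseval, ofReal_integral_eq_lintegral_ofReal hint
            (ae_of_all _ fun t => by positivity)]
      _ = ∫⁻ x, ENNReal.ofReal (Real.exp (-(v / 2) * x ^ 2)) ∂ρ := by
          refine ofReal_integral_eq_lintegral_ofReal ?_ (ae_of_all _ fun t => by positivity)
          refine (integrable_const (1 : ℝ)).mono' (by fun_prop) (ae_of_all _ fun t => ?_)
          rw [Real.norm_of_nonneg (Real.exp_pos _).le, Real.exp_le_one_iff]
          have : 0 ≤ v / 2 * t ^ 2 := by positivity
          linarith
      _ ≤ ∫⁻ x, ENNReal.ofReal (Real.exp (-(v / 2) * x ^ 2)) ∂(ENNReal.ofReal K • volume) :=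
          lintegral_mono' (conv_le_smul_volume h) le_rfl
      _ = ENNReal.ofReal K * ENNReal.ofReal √(Real.pi / (v / 2)) := by
          rw [lintegral_smul_measure, smul_eq_mul, ← integral_gaussian,
            ofReal_integral_eq_lintegral_ofReal (integrable_exp_neg_mul_sq (by positivity))
              (ae_of_all _ fun t => by positivity)]
  rw [gaussianReal_of_var_ne_zero _ hv.ne', lintegral_withDensity_eq_lintegral_mul _
    (measurable_gaussianPDF _ _) (by fun_prop)] at hgauss
  calc ∫⁻ t, ENNReal.ofReal (Real.exp (-t ^ 2 / (2 * v))) * ‖MeasureTheory.charFun ν t‖ₑ ^ 2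
      = ∫⁻ t, ENNReal.ofReal √(2 * Real.pi * v)
          * (gaussianPDF 0 v * fun t => ‖MeasureTheory.charFun ν t‖ₑ ^ 2) t := by
        refine lintegral_congr fun t => ?_
        rw [Pi.mul_apply, ← mul_assoc, gaussianPDF, gaussianPDFReal,
          ← ENNReal.ofReal_mul (Real.sqrt_nonneg _), mul_inv_cancel_left₀ (by positivity), sub_zero]
    _ ≤ ENNReal.ofReal √(2 * Real.pi * v)
          * (ENNReal.ofReal K * ENNReal.ofReal √(Real.pi / (v / 2))) := by
        rw [lintegral_const_mul' _ _ ENNReal.ofReal_ne_top]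
        gcongr
    _ = ENNReal.ofReal (2 * Real.pi * K) := by
        rw [mul_left_comm, ← ENNReal.ofReal_mul (Real.sqrt_nonneg _),
          ← Real.sqrt_mul (by positivity), mul_comm, ← ENNReal.ofReal_mul (Real.sqrt_nonneg _)]
        have : 2 * Real.pi * v * (Real.pi / (v / 2)) = (2 * Real.pi) ^ 2 := by field_simp
        rw [this, Real.sqrt_sq (by positivity)]

open Filter Topology in
/-- The Plancherel bound `∫ |φ|² ≤ 2πK` for a law with density bounded by `K`. -/
lemma lintegral_enorm_charFun_sq_le {ν : Measure ℝ} [IsProbabilityMeasure ν] {K : ℝ}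
    (h : ν ≤ ENNReal.ofReal K • volume) :
    ∫⁻ t, ‖MeasureTheory.charFun ν t‖ₑ ^ 2 ≤ ENNReal.ofReal (2 * Real.pi * K) := by
  have hcont : Continuous (MeasureTheory.charFun ν) := continuous_charFun
  let F (n : ℕ) (t : ℝ) : ENNReal :=
    ENNReal.ofReal (Real.exp (-t ^ 2 / (2 * ((n + 1 : NNReal) : ℝ))))
      * ‖MeasureTheory.charFun ν t‖ₑ ^ 2
  have hlim (t : ℝ) : Tendsto (fun n => F n t) atTop (𝓝 (‖MeasureTheory.charFun ν t‖ₑ ^ 2)) := by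
    have h1 : Tendsto (fun n : ℕ => 2 * ((n + 1 : NNReal) : ℝ)) atTop atTop := by
      push_cast
      exact (tendsto_natCast_atTop_atTop.atTop_add tendsto_const_nhds).const_mul_atTop two_pos
    have h2 := ENNReal.tendsto_ofReal
      ((Real.continuous_exp.tendsto 0).comp (h1.const_div_atTop (-t ^ 2)))
    simpa [F] using ENNReal.Tendsto.mul_const h2 (b := ‖MeasureTheory.charFun ν t‖ₑ ^ 2)
      (Or.inl (by simp))
  calc ∫⁻ t, ‖MeasureTheory.charFun ν t‖ₑ ^ 2
      = ∫⁻ t, liminf (fun n => F n t) atTop := lintegral_congr fun t => (hlim t).liminf_eq.symm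
    _ ≤ liminf (fun n => ∫⁻ t, F n t) atTop := lintegral_liminf_le fun n => by
        dsimp only [F]
        fun_prop
    _ ≤ ENNReal.ofReal (2 * Real.pi * K) := by
        refine liminf_le_of_le (by isBoundedDefault) fun b hb => ?_
        obtain ⟨n, hn⟩ := hb.exists
        exact hn.trans (lintegral_exp_mul_enorm_charFun_sq_le h (by positivity))

lemma volume_lt_norm_charFun_le {ν : Measure ℝ} [IsProbabilityMeasure ν] {K : ℝ}
    (h : ν ≤ ENNReal.ofReal K • volume) {s : ℝ} (hs : 0 < s) :
    volume {t | s < ‖MeasureTheory.charFun ν t‖} ≤ ENNReal.ofReal (2 * Real.pi * K / s ^ 2) := by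
  have hcont : Continuous (MeasureTheory.charFun ν) := continuous_charFun
  have hs2 : 0 < s ^ 2 := by positivity
  calc volume {t | s < ‖MeasureTheory.charFun ν t‖}
      ≤ volume {t | ENNReal.ofReal (s ^ 2) ≤ ‖MeasureTheory.charFun ν t‖ₑ ^ 2} := by
        refine measure_mono fun t ht => ?_
        simp only [Set.mem_ofPred_eq] at ht ⊢
        rw [← ofReal_norm, ENNReal.ofReal_pow hs.le]
        gcongr
    _ ≤ (∫⁻ t, ‖MeasureTheory.charFun ν t‖ₑ ^ 2) / ENNReal.ofReal (s ^ 2) :=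
        meas_ge_le_lintegral_div (by fun_prop) (by simpa using hs.ne') ENNReal.ofReal_ne_top
    _ ≤ ENNReal.ofReal (2 * Real.pi * K / s ^ 2) := by
        rw [ENNReal.ofReal_div_of_pos hs2]
        gcongr
        exact lintegral_enorm_charFun_sq_le h

lemma one_sub_re_mul_le {z w : ℂ} (hz : ‖z‖ = 1) (hw : ‖w‖ = 1) :
    1 - (z * w).re ≤ 2 * (1 - z.re) + 2 * (1 - w.re) := by
  have hz' : z.re ^ 2 + z.im ^ 2 = 1 := by
    rw [← one_pow 2, ← hz, Complex.sq_norm, Complex.normSq_apply]; ring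
  have hw' : w.re ^ 2 + w.im ^ 2 = 1 := by
    rw [← one_pow 2, ← hw, Complex.sq_norm, Complex.normSq_apply]; ring
  rw [Complex.mul_re]
  nlinarith [sq_nonneg (z.re + w.re - 2), sq_nonneg (z.im - w.im), sq_nonneg (z.im + w.im)]

lemma exists_norm_eq_one_mul_eq_norm (z : ℂ) : ∃ u : ℂ, ‖u‖ = 1 ∧ u * z = ‖z‖ := by
  refine ⟨Complex.exp ((-z.arg : ℝ) * Complex.I), Complex.norm_exp_ofReal_mul_I _, ?_⟩
  conv_lhs => rw [← Complex.norm_mul_exp_arg_mul_I z]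
  rw [mul_left_comm, ← Complex.exp_add]
  simp

lemma one_sub_norm_charFun_add_le (ν : Measure ℝ) [IsProbabilityMeasure ν] (s t : ℝ) :
    1 - ‖MeasureTheory.charFun ν (s + t)‖ ≤
      2 * (1 - ‖MeasureTheory.charFun ν s‖) + 2 * (1 - ‖MeasureTheory.charFun ν t‖) := by
  obtain ⟨u, hu, hus⟩ := exists_norm_eq_one_mul_eq_norm (MeasureTheory.charFun ν s)
  obtain ⟨w, hw, hwt⟩ := exists_norm_eq_one_mul_eq_norm (MeasureTheory.charFun ν t)
  let e (r x : ℝ) : ℂ := Complex.exp ((r * x : ℝ) * Complex.I)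
  have he (r x : ℝ) : ‖e r x‖ = 1 := Complex.norm_exp_ofReal_mul_I _
  have hint (a : ℂ) (r : ℝ) : Integrable (fun x => a * e r x) ν := by
    refine Integrable.const_mul ?_ a
    refine (integrable_const (1 : ℝ)).mono' (by fun_prop) (ae_of_all _ fun x => ?_)
    rw [he]
  have hre (a : ℂ) (r : ℝ) : ∫ x, (a * e r x).re ∂ν = (a * MeasureTheory.charFun ν r).re := by
    have h1 : ∫ x, (a * e r x).re ∂ν = (∫ x, a * e r x ∂ν).re := integral_re (hint a r)
    rw [h1, integral_const_mul, charFun_apply_real]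
    simp only [e, Complex.ofReal_mul]
  have hone (a : ℂ) (r : ℝ) : Integrable (fun x => 1 - (a * e r x).re) ν :=
    (integrable_const 1).sub (hint a r).re
  have hval (a : ℂ) (r : ℝ) :
      ∫ x, (1 - (a * e r x).re) ∂ν = 1 - (a * MeasureTheory.charFun ν r).re := by
    have hsub := integral_sub (integrable_const (1 : ℝ)) (hint a r).re
    simp only [RCLike.re_to_complex] at hsub
    rw [hsub, hre]
    simp
  have hmono : ∫ x, (1 - ((u * w) * e (s + t) x).re) ∂ν
      ≤ ∫ x, (2 * (1 - (u * e s x).re) + 2 * (1 - (w * e t x).re)) ∂ν := by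
    refine integral_mono (hone _ _) (((hone u s).const_mul 2).add ((hone w t).const_mul 2))
      fun x => ?_
    have h1 : (u * w) * e (s + t) x = (u * e s x) * (w * e t x) := by
      have : e (s + t) x = e s x * e t x := by
        simp only [e, ← Complex.exp_add]
        push_cast
        ring_nf
      rw [this]
      ring
    dsimp only
    rw [h1]
    exact one_sub_re_mul_le (by rw [norm_mul, hu, he, one_mul]) (by rw [norm_mul, hw, he, one_mul])
  rw [hval, integral_add ((hone u s).const_mul 2) ((hone w t).const_mul 2), integral_const_mul,
    integral_const_mul, hval, hval, hus, hwt, Complex.ofReal_re, Complex.ofReal_re] at hmono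
  have hle := Complex.re_le_norm (u * w * MeasureTheory.charFun ν (s + t))
  rw [norm_mul, norm_mul, hu, hw, one_mul, one_mul] at hle
  linarith

open Pointwise in
/-- Quadrupling the deficit `1 - |φ|` at least doubles the measure of the super-level set. -/
lemma two_mul_volume_one_sub_lt_norm_charFun_le (ν : Measure ℝ) [IsProbabilityMeasure ν] (ε : ℝ) :
    2 * volume {t | 1 - ε < ‖MeasureTheory.charFun ν t‖}
      ≤ volume {t | 1 - 4 * ε < ‖MeasureTheory.charFun ν t‖} := by
  have hcont : Continuous (MeasureTheory.charFun ν) := continuous_charFun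
  have hopen : IsOpen {t | 1 - ε < ‖MeasureTheory.charFun ν t‖} :=
    isOpen_lt continuous_const hcont.norm
  rw [hopen.measure_eq_iSup_isCompact]
  simp_rw [ENNReal.mul_iSup]
  refine iSup₂_le fun C hC => iSup_le fun hCc => ?_
  refine (two_mul_volume_le_volume_add_self hCc).trans (measure_mono ?_)
  rintro _ ⟨s, hs, t, ht, rfl⟩
  have h1 : 1 - ε < ‖MeasureTheory.charFun ν s‖ := hC hs
  have h2 : 1 - ε < ‖MeasureTheory.charFun ν t‖ := hC ht
  have h3 := one_sub_norm_charFun_add_le ν s t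
  simp only [Set.mem_ofPred_eq]
  linarith

lemma two_pow_mul_volume_one_sub_lt_norm_charFun_le (ν : Measure ℝ) [IsProbabilityMeasure ν]
    (ε : ℝ) (m : ℕ) :
    2 ^ m * volume {t | 1 - ε < ‖MeasureTheory.charFun ν t‖}
      ≤ volume {t | 1 - 4 ^ m * ε < ‖MeasureTheory.charFun ν t‖} := by
  induction m with
  | zero => simp
  | succ m ih =>
    calc 2 ^ (m + 1) * volume {t | 1 - ε < ‖MeasureTheory.charFun ν t‖}
        = 2 * (2 ^ m * volume {t | 1 - ε < ‖MeasureTheory.charFun ν t‖}) := by ring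
      _ ≤ 2 * volume {t | 1 - 4 ^ m * ε < ‖MeasureTheory.charFun ν t‖} := by gcongr
      _ ≤ _ := two_mul_volume_one_sub_lt_norm_charFun_le ν _
      _ = _ := by rw [pow_succ', mul_assoc]

lemma HasDensityLE.le_smul {E : Type*} [MeasurableSpace E] {ν μ : Measure E} {K : ℝ}
    (h : HasDensityLE ν μ K) : ν ≤ ENNReal.ofReal K • μ := by
  obtain ⟨f, rfl, hf⟩ := h
  rw [← withDensity_const]
  exact withDensity_mono hf

lemma charFun_eq_charFun_map {Ω : Type*} [MeasurableSpace Ω] {μ : Measure Ω} {X : Ω → ℝ}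
    (hX : Measurable X) (t : ℝ) :
    _root_.charFun μ X t = MeasureTheory.charFun (μ.map X) t := by
  rw [charFun_apply_real, integral_map hX.aemeasurable (by fun_prop), _root_.charFun]
  refine integral_congr_ae (ae_of_all _ fun ω => ?_)
  ring_nf

lemma volume_one_sub_lt_norm_charFun_le {ν : Measure ℝ} [IsProbabilityMeasure ν] {K : ℝ}
    (h : ν ≤ ENNReal.ofReal K • volume) {t : ℝ} (ht : 0 < t) (htK : t < 2 * Real.pi * K) :
    volume {τ | 1 - 1 / (512 * Real.pi ^ 2) * (t / K) ^ 2 < ‖MeasureTheory.charFun ν τ‖}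
      ≤ ENNReal.ofReal t := by
  have hpi := Real.pi_pos
  have hK : 0 < K := by
    by_contra! hK
    nlinarith
  obtain ⟨m, hm1, hm2⟩ := exists_nat_pow_near (x := 8 * Real.pi * K / t) (y := 2)
    (by rw [le_div_iff₀ ht]; nlinarith) one_lt_two
  rw [le_div_iff₀ ht] at hm1
  rw [div_lt_iff₀ ht] at hm2
  have hhalf : 4 ^ (m + 1) * (1 / (512 * Real.pi ^ 2) * (t / K) ^ 2) ≤ 1 / 2 := by
    have h1 : (2 ^ m * t) ^ 2 ≤ (8 * Real.pi * K) ^ 2 := by gcongr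
    have h4 : (4 : ℝ) ^ m = 2 ^ m * 2 ^ m := by rw [← mul_pow]; norm_num
    rw [div_pow, div_mul_div_comm, one_mul, ← mul_div_assoc, div_le_div_iff₀ (by positivity) two_pos,
      pow_succ, h4]
    nlinarith
  have hmarkov : volume {τ | 1 / 2 < ‖MeasureTheory.charFun ν τ‖}
      ≤ ENNReal.ofReal (2 ^ (m + 1) * t) :=
    (volume_lt_norm_charFun_le h one_half_pos).trans (ENNReal.ofReal_le_ofReal <| by
      ring_nf at hm2 ⊢
      linarith)
  have hpow : ENNReal.ofReal (2 ^ (m + 1) * t) = 2 ^ (m + 1) * ENNReal.ofReal t := by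
    rw [ENNReal.ofReal_mul (by positivity), ENNReal.ofReal_pow zero_le_two, ENNReal.ofReal_ofNat]
  rw [← ENNReal.mul_le_mul_iff_right (a := 2 ^ (m + 1)) (by simp) (by simp), ← hpow]
  refine (two_pow_mul_volume_one_sub_lt_norm_charFun_le ν _ (m + 1)).trans ?_
  refine (measure_mono fun τ hτ => ?_).trans hmarkov
  simp only [Set.mem_ofPred_eq] at hτ ⊢
  linarith

/-- **Decay of characteristic functions.** If `X` has density bounded by `K`, then the
non-increasing rearrangement of `|φ_X|` satisfies `|φ_X|*(t) ≤ 1 - c(t/K)²` for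
`0 < t < 2πK` and `|φ_X|*(t) ≤ √(2πK/t)` for `t ≥ 2πK`; equivalently, the super-level sets
of `|φ_X|` at these heights have Lebesgue measure at most `t`. -/
theorem charFun_decay_of_density_le :
    ∃ c : ℝ, 0 < c ∧
      ∀ (Ω : Type) [MeasureSpace Ω], ∀ (_ : IsProbabilityMeasure (ℙ : Measure Ω))
        (K : ℝ) (X : Ω → ℝ), Measurable X →
        HasDensityLE (Measure.map X ℙ) volume K →
        (∀ t : ℝ, 0 < t → t < 2 * Real.pi * K →
          volume {τ : ℝ | 1 - c * (t / K) ^ 2 < ‖charFun ℙ X τ‖} ≤ ENNReal.ofReal t) ∧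
        (∀ t : ℝ, 2 * Real.pi * K ≤ t →
          volume {τ : ℝ | Real.sqrt (2 * Real.pi * K / t) < ‖charFun ℙ X τ‖}
            ≤ ENNReal.ofReal t) := by
  refine ⟨1 / (512 * Real.pi ^ 2), by positivity, fun Ω _ _ K X hX hdens => ?_⟩
  have : IsProbabilityMeasure (Measure.map X ℙ) :=
    Measure.isProbabilityMeasure_map hX.aemeasurable
  have hle := hdens.le_smul
  have hK : 0 < K := by
    by_contra! hK
    rw [ENNReal.ofReal_of_nonpos hK, zero_smul] at hle
    exact IsProbabilityMeasure.ne_zero _ (le_antisymm hle (Measure.zero_le _))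
  simp_rw [charFun_eq_charFun_map hX]
  refine ⟨fun t ht htK => volume_one_sub_lt_norm_charFun_le hle ht htK, fun t htK => ?_⟩
  have hpos : 0 < 2 * Real.pi * K := by positivity
  have ht : 0 < t := hpos.trans_le htK
  refine (volume_lt_norm_charFun_le hle (Real.sqrt_pos.2 (div_pos hpos ht))).trans_eq ?_
  rw [Real.sq_sqrt (div_pos hpos ht).le, div_div_cancel₀ hpos.ne']
end

section
/- There exists an absolute constant C > 0 such that the following holds. Let Z_1, Z_2 ≥ 0 be random variables on a common probability space and let M_1, M_2, p ≥ 0 be real numbers. Assume: (i) ℙ(Z_1 ≤ t | Z_2) ≤ M_1·t almost surely for all t ≥ 0; and (ii) ℙ(Z_2 ≤ t) ≤ M_2·t^p for all t ≥ 0. Then ℙ(√(Z_1² + Z_2²) ≤ t) ≤ (C·M_1·M_2 / √(p+1)) · t^{p+1} for all t ≥ 0. -/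
open MeasureTheory ProbabilityTheory

/-- A uniform bound on a conditional probability given `m` bounds the probability of the
intersection with any `m`-measurable event. -/
lemma measureReal_inter_le_of_condExp_le {Ω : Type*} {m m₀ : MeasurableSpace Ω}
    {μ : Measure Ω} [IsFiniteMeasure μ] (hm : m ≤ m₀) {A B : Set Ω}
    (hA : MeasurableSet A) (hB : MeasurableSet[m] B) {c : ℝ}
    (h : ∀ᵐ ω ∂μ, (μ⟦A | m⟧) ω ≤ c) : μ.real (A ∩ B) ≤ c * μ.real B := by
  have hint : Integrable (A.indicator fun _ => (1 : ℝ)) μ :=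
    (integrable_const (1 : ℝ)).indicator hA
  calc μ.real (A ∩ B) = ∫ ω in B, A.indicator (fun _ => (1 : ℝ)) ω ∂μ := by
        rw [setIntegral_indicator hA, setIntegral_const, smul_eq_mul, mul_one, Set.inter_comm]
    _ = ∫ ω in B, (μ⟦A | m⟧) ω ∂μ := (setIntegral_condExp hm hint hB).symm
    _ ≤ ∫ _ in B, c ∂μ := by
        refine setIntegral_mono_ae integrable_condExp.integrableOn
          (integrable_const c).integrableOn h
    _ = c * μ.real B := by rw [setIntegral_const, smul_eq_mul, mul_comm]

/-- A point of the disc of radius `t` lies in one of the rectangles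
`[0, t √((k + 1) / q)] × [0, t √(1 - k / q)]` with `k ≤ q`. -/
lemma exists_nat_le_mul_sqrt {x y t q : ℝ} (hx : 0 ≤ x) (hy : 0 ≤ y) (ht : 0 < t) (hq : 0 < q)
    (h : x ^ 2 + y ^ 2 ≤ t ^ 2) :
    ∃ k : ℕ, (k : ℝ) ≤ q ∧ x ≤ t * √((k + 1) / q) ∧ y ≤ t * √(1 - k / q) := by
  have ht2 : 0 < t ^ 2 := by positivity
  have hu : 0 ≤ q * x ^ 2 / t ^ 2 := by positivity
  set k := ⌊q * x ^ 2 / t ^ 2⌋₊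
  have hk : (k : ℝ) ≤ q * x ^ 2 / t ^ 2 := Nat.floor_le hu
  have hk' : q * x ^ 2 / t ^ 2 < k + 1 := Nat.lt_floor_add_one _
  rw [le_div_iff₀ ht2] at hk
  rw [div_lt_iff₀ ht2] at hk'
  have hkq : (k : ℝ) ≤ q := by
    refine le_of_mul_le_mul_right (hk.trans ?_) ht2
    gcongr
    nlinarith [sq_nonneg y]
  have hsub : 0 ≤ 1 - k / q := sub_nonneg.2 ((div_le_one hq).2 hkq)
  refine ⟨k, hkq, ?_, ?_⟩
  · refine (pow_le_pow_iff_left₀ hx (by positivity) two_ne_zero).1 ?_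
    rw [mul_pow, Real.sq_sqrt (by positivity), ← mul_div_assoc, le_div_iff₀ hq]
    linarith
  · refine (pow_le_pow_iff_left₀ hy (by positivity) two_ne_zero).1 ?_
    rw [mul_pow, Real.sq_sqrt hsub]
    have : k / q * t ^ 2 ≤ x ^ 2 := by
      rw [div_mul_eq_mul_div, div_le_iff₀ hq]
      linarith
    linarith

lemma sqrt_one_sub_div_rpow_le {p : ℝ} (hp : 0 ≤ p) {k : ℕ} (hk : (k : ℝ) ≤ p + 1) :
    √(1 - k / (p + 1)) ^ p ≤ Real.exp (1 / 2) * Real.exp (-1 / 2) ^ k := by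
  have hq : 0 < p + 1 := by linarith
  have hsub : 0 ≤ 1 - k / (p + 1) := sub_nonneg.2 ((div_le_one hq).2 hk)
  have hbase : √(1 - k / (p + 1)) ≤ Real.exp (-(k / (p + 1)) / 2) := by
    rw [Real.exp_half]
    refine Real.sqrt_le_sqrt ?_
    linarith [Real.add_one_le_exp (-(k / (p + 1)))]
  refine (Real.rpow_le_rpow (Real.sqrt_nonneg _) hbase hp).trans ?_
  rw [← Real.exp_mul, ← Real.exp_nat_mul, ← Real.exp_add, Real.exp_le_exp]
  have : k / (p + 1) * p = k - k / (p + 1) := by field_simp; ring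
  have h1 : k / (p + 1) ≤ 1 := (div_le_one hq).2 hk
  linarith

lemma summable_succ_mul_exp_neg_half_pow :
    Summable fun k : ℕ => ((k : ℝ) + 1) * (Real.exp (1 / 2) * Real.exp (-1 / 2) ^ k) := by
  have hr : ‖Real.exp (-1 / 2)‖ < 1 := by
    rw [Real.norm_of_nonneg (Real.exp_pos _).le, Real.exp_lt_one_iff]
    norm_num
  have h1 := summable_pow_mul_geometric_of_norm_lt_one 1 hr
  have h0 := summable_geometric_of_norm_lt_one hr
  refine ((h1.add h0).mul_left (Real.exp (1 / 2))).congr fun k => ?_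
  ring

/-- **Tensorization of small ball probabilities.** If `ℙ(Z₁ ≤ t | Z₂) ≤ M₁ t` almost surely and
`ℙ(Z₂ ≤ t) ≤ M₂ tᵖ` for all `t ≥ 0`, then
`ℙ(√(Z₁² + Z₂²) ≤ t) ≤ (C M₁ M₂ / √(p+1)) t^{p+1}` for all `t ≥ 0`. -/
theorem small_ball_tensorization :
    ∃ C : ℝ, 0 < C ∧
      ∀ (Ω : Type) [MeasureSpace Ω], ∀ (_ : IsProbabilityMeasure (ℙ : Measure Ω))
        (Z₁ Z₂ : Ω → ℝ), Measurable Z₁ → Measurable Z₂ →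
        (∀ ω, 0 ≤ Z₁ ω) → (∀ ω, 0 ≤ Z₂ ω) →
        ∀ (M₁ M₂ p : ℝ), 0 ≤ M₁ → 0 ≤ M₂ → 0 ≤ p →
        (∀ t : ℝ, 0 ≤ t → ∀ᵐ ω ∂ℙ,
          (ℙ⟦{ω' | Z₁ ω' ≤ t} | MeasurableSpace.comap Z₂ inferInstance⟧) ω ≤ M₁ * t) →
        (∀ t : ℝ, 0 ≤ t → ℙ {ω | Z₂ ω ≤ t} ≤ ENNReal.ofReal (M₂ * t ^ p)) →
        ∀ t : ℝ, 0 ≤ t →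
          ℙ {ω | Real.sqrt (Z₁ ω ^ 2 + Z₂ ω ^ 2) ≤ t}
            ≤ ENNReal.ofReal (C * M₁ * M₂ / Real.sqrt (p + 1) * t ^ (p + 1)) := by
  set f : ℕ → ℝ := fun k => ((k : ℝ) + 1) * (Real.exp (1 / 2) * Real.exp (-1 / 2) ^ k)
  have hf0 : ∀ k, 0 < f k := fun k => by positivity
  have hfs : Summable f := summable_succ_mul_exp_neg_half_pow
  refine ⟨∑' k, f k, hfs.tsum_pos (fun k => (hf0 k).le) 0 (hf0 0), ?_⟩
  intro Ω _ _ Z₁ Z₂ hZ₁ hZ₂ hZ₁0 hZ₂0 M₁ M₂ p hM₁ hM₂ hp hc hs t ht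
  have hq : 0 < p + 1 := by linarith
  have rect (a b : ℝ) (ha : 0 ≤ a) (hb : 0 ≤ b) :
      (ℙ : Measure Ω).real ({ω | Z₁ ω ≤ a} ∩ {ω | Z₂ ω ≤ b}) ≤ M₁ * a * (M₂ * b ^ p) := by
    refine (measureReal_inter_le_of_condExp_le hZ₂.comap_le (hZ₁ measurableSet_Iic)
      ⟨Set.Iic b, measurableSet_Iic, rfl⟩ (hc a ha)).trans ?_
    gcongr
    exact ENNReal.toReal_le_of_le_ofReal (by positivity) (hs b hb)
  rw [ENNReal.le_ofReal_iff_toReal_le (measure_ne_top _ _) (by positivity)]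
  change (ℙ : Measure Ω).real _ ≤ _
  rcases ht.eq_or_lt with rfl | ht
  · rw [Real.zero_rpow hq.ne', mul_zero]
    refine (measureReal_mono ?_).trans ((rect 0 0 le_rfl le_rfl).trans_eq (by simp))
    intro ω hω
    have h : Z₁ ω ^ 2 + Z₂ ω ^ 2 ≤ 0 := by
      simpa using Real.sqrt_le_left le_rfl |>.1 hω
    constructor
    · change Z₁ ω ≤ 0
      nlinarith [sq_nonneg (Z₂ ω), sq_nonneg (Z₁ ω)]
    · change Z₂ ω ≤ 0
      nlinarith [sq_nonneg (Z₁ ω)]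
  set N := ⌊p + 1⌋₊ + 1
  have hN {k : ℕ} : k ∈ Finset.range N ↔ (k : ℝ) ≤ p + 1 := by
    rw [Finset.mem_range, Nat.lt_succ_iff, Nat.le_floor_iff hq.le]
  have hcover : {ω | √(Z₁ ω ^ 2 + Z₂ ω ^ 2) ≤ t} ⊆ ⋃ k ∈ Finset.range N,
      {ω | Z₁ ω ≤ t * √((k + 1) / (p + 1))} ∩ {ω | Z₂ ω ≤ t * √(1 - k / (p + 1))} := by
    intro ω hω
    obtain ⟨k, hk, h1, h2⟩ := exists_nat_le_mul_sqrt (hZ₁0 ω) (hZ₂0 ω) ht hq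
      ((Real.sqrt_le_left ht.le).1 hω)
    exact Set.mem_biUnion (hN.2 hk) ⟨h1, h2⟩
  refine (measureReal_mono hcover (measure_ne_top _ _)).trans <| (measureReal_biUnion_finset_le _ _).trans ?_
  have hterm : ∀ k ∈ Finset.range N,
      (ℙ : Measure Ω).real ({ω | Z₁ ω ≤ t * √((k + 1) / (p + 1))} ∩
        {ω | Z₂ ω ≤ t * √(1 - k / (p + 1))}) ≤ f k * (M₁ * M₂ / √(p + 1) * t ^ (p + 1)) := by
    intro k hk
    refine (rect _ _ (by positivity) (by positivity)).trans ?_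
    have h1 : √((k : ℝ) + 1) ≤ k + 1 := by
      rw [Real.sqrt_le_left (by positivity)]
      nlinarith [(Nat.cast_nonneg k : (0 : ℝ) ≤ k)]
    calc M₁ * (t * √((k + 1) / (p + 1))) * (M₂ * (t * √(1 - k / (p + 1))) ^ p)
        = √((k : ℝ) + 1) * √(1 - k / (p + 1)) ^ p * (M₁ * M₂ / √(p + 1) * t ^ (p + 1)) := by
          rw [Real.mul_rpow ht.le (Real.sqrt_nonneg _), Real.sqrt_div (by positivity),
            Real.rpow_add_one ht.ne']
          ring
      _ ≤ f k * (M₁ * M₂ / √(p + 1) * t ^ (p + 1)) := by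
          gcongr
          exact mul_le_mul h1 (sqrt_one_sub_div_rpow_le hp (hN.1 hk)) (by positivity)
            (by positivity)
  refine (Finset.sum_le_sum hterm).trans ?_
  rw [← Finset.sum_mul]
  calc _ ≤ (∑' k, f k) * (M₁ * M₂ / √(p + 1) * t ^ (p + 1)) := by
        gcongr
        exact hfs.sum_le_tsum _ fun k _ => (hf0 k).le
    _ = _ := by ring
end

section
/- There exists an absolute constant c > 0 such that the following holds. Let Z_1, Z_2 ≥ 0 be random variables on a common probability space, let K_1, K_2 ≥ 0 and d > 1 be real numbers, and assume: (i) ℙ(Z_1 ≤ t | Z_2) ≤ K_1·t almost surely for all t ≥ 0; (ii) ℙ(Z_2 ≤ t·√(d−1)) ≤ (K_2·t)^{d−1} for all t ≥ 0; and (iii) K_1 ≤ c·K_2. Then ℙ(√(Z_1² + Z_2²) ≤ t·√d) ≤ (K_2·t)^d for all t ≥ 0. -/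
open MeasureTheory ProbabilityTheory

/-- A bound linear in `t` on the conditional probability of `{Y ≤ t}` given `X`, for each `t`,
gives the same bound for the regular conditional distribution, simultaneously in `t`. -/
lemma ae_condDistrib_Iic_le {Ω : Type*} [MeasurableSpace Ω] {μ : Measure Ω}
    [IsProbabilityMeasure μ] {X Y : Ω → ℝ} (hX : Measurable X) (hY : Measurable Y) {K : ℝ}
    (h : ∀ t : ℝ, 0 ≤ t → ∀ᵐ ω ∂μ,
      (μ⟦{ω' | Y ω' ≤ t} | MeasurableSpace.comap X inferInstance⟧) ω ≤ K * t) :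
    ∀ᵐ ω ∂μ, ∀ t : ℝ, 0 ≤ t →
      condDistrib Y X μ (X ω) (Set.Iic t) ≤ ENNReal.ofReal (K * t) := by
  have hrat : ∀ᵐ ω ∂μ, ∀ q : ℚ, 0 ≤ (q : ℝ) →
      condDistrib Y X μ (X ω) (Set.Iic (q : ℝ)) ≤ ENNReal.ofReal (K * q) := by
    rw [ae_all_iff]
    intro q
    by_cases hq : 0 ≤ (q : ℝ)
    · filter_upwards [h q hq, condDistrib_ae_eq_condExp (μ := μ) hX hY
        (measurableSet_Iic (a := (q : ℝ)))] with ω h1 h2 _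
      have h3 : (condDistrib Y X μ (X ω)).real (Set.Iic (q : ℝ)) ≤ K * q := h2.trans_le h1
      rw [← ENNReal.ofReal_toReal (measure_ne_top (condDistrib Y X μ (X ω)) (Set.Iic (q : ℝ)))]
      exact ENNReal.ofReal_le_ofReal h3
    · exact Filter.Eventually.of_forall fun ω h0 => absurd h0 hq
  filter_upwards [hrat] with ω hω t ht
  obtain ⟨u, -, hu, hlim⟩ := Real.exists_seq_rat_strictAnti_tendsto t
  refine ge_of_tendsto' (ENNReal.tendsto_ofReal (hlim.const_mul K)) fun n => ?_
  exact (measure_mono (Set.Iic_subset_Iic.2 (hu n).le)).trans (hω (u n) (ht.trans (hu n).le))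

/-- If the conditional distribution function of `Z₁ ≥ 0` given `Z₂` is at most linear, then the
probability of a disc is controlled by the mean length of its vertical sections. -/
lemma measure_sqrt_sq_add_sq_le {Ω : Type*} [MeasurableSpace Ω] {μ : Measure Ω}
    [IsProbabilityMeasure μ] {Z₁ Z₂ : Ω → ℝ} (hZ₁ : Measurable Z₁) (hZ₂ : Measurable Z₂)
    {K : ℝ} (hK : 0 ≤ K)
    (h : ∀ t : ℝ, 0 ≤ t → ∀ᵐ ω ∂μ,
      (μ⟦{ω' | Z₁ ω' ≤ t} | MeasurableSpace.comap Z₂ inferInstance⟧) ω ≤ K * t)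
    {s : ℝ} (hs : 0 ≤ s) :
    μ {ω | Real.sqrt (Z₁ ω ^ 2 + Z₂ ω ^ 2) ≤ s} ≤
      ENNReal.ofReal K * ∫⁻ ω, ENNReal.ofReal (Real.sqrt (s ^ 2 - Z₂ ω ^ 2)) ∂μ := by
  have hS : MeasurableSet {p : ℝ × ℝ | Real.sqrt (p.2 ^ 2 + p.1 ^ 2) ≤ s} :=
    measurableSet_le (by fun_prop) measurable_const
  have heq : μ {ω | Real.sqrt (Z₁ ω ^ 2 + Z₂ ω ^ 2) ≤ s} =
      ∫⁻ ω, condDistrib Z₁ Z₂ μ (Z₂ ω) {x | Real.sqrt (x ^ 2 + Z₂ ω ^ 2) ≤ s} ∂μ := by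
    have h1 := compProd_map_condDistrib (mβ := inferInstance) (μ := μ) (X := Z₂) hZ₁.aemeasurable
    have h2 : μ {ω | Real.sqrt (Z₁ ω ^ 2 + Z₂ ω ^ 2) ≤ s} =
        (μ.map fun ω => (Z₂ ω, Z₁ ω)) {p : ℝ × ℝ | Real.sqrt (p.2 ^ 2 + p.1 ^ 2) ≤ s} := by
      rw [Measure.map_apply (hZ₂.prodMk hZ₁) hS]
      rfl
    rw [h2, ← h1, Measure.compProd_apply hS,
      lintegral_map (Kernel.measurable_kernel_prodMk_left hS) hZ₂]
    rfl
  rw [heq, ← lintegral_const_mul _ (by fun_prop)]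
  refine lintegral_mono_ae ?_
  filter_upwards [ae_condDistrib_Iic_le hZ₂ hZ₁ h] with ω hω
  rw [← ENNReal.ofReal_mul hK]
  refine (measure_mono fun x hx => ?_).trans (hω _ (Real.sqrt_nonneg _))
  have hx' : x ^ 2 + Z₂ ω ^ 2 ≤ s ^ 2 := (Real.sqrt_le_left hs).1 hx
  exact Real.le_sqrt_of_sq_le (by linarith)

lemma rpow_sqrt_div_sqrt_le_exp {d w : ℝ} (hd : 1 < d) (hw : w ≤ d) :
    (Real.sqrt (d - w) / Real.sqrt (d - 1)) ^ (d - 1) ≤ Real.exp ((1 - w) / 2) := by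
  have hd' : 0 < d - 1 := by linarith
  have h : Real.sqrt (d - w) / Real.sqrt (d - 1) ≤ Real.exp ((1 - w) / (2 * (d - 1))) := by
    rw [← Real.sqrt_div (by linarith)]
    refine Real.sqrt_le_iff.2 ⟨(Real.exp_pos _).le, ?_⟩
    rw [← Real.exp_nat_mul]
    have h2 : (d - w) / (d - 1) = (1 - w) / (d - 1) + 1 := by field_simp; ring
    have h3 : ((2 : ℕ) : ℝ) * ((1 - w) / (2 * (d - 1))) = (1 - w) / (d - 1) := by
      push_cast; field_simp
    rw [h2, h3]
    exact Real.add_one_le_exp _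
  refine (Real.rpow_le_rpow (by positivity) h hd'.le).trans_eq ?_
  rw [← Real.exp_mul]
  congr 1
  field_simp

/-- Under a small ball bound for `Z ≥ 0` in dimension `d - 1`, the mean length of the sections of
a disc of radius `t √d` is bounded independently of the dimension. -/
lemma lintegral_sqrt_sub_sq_le {Ω : Type*} [MeasurableSpace Ω] {μ : Measure Ω}
    {Z : Ω → ℝ} (hZ : Measurable Z) {K d t : ℝ} (hK : 0 ≤ K) (hd : 1 < d) (ht : 0 < t)
    (h : ∀ t : ℝ, 0 ≤ t →
      μ {ω | Z ω ≤ t * Real.sqrt (d - 1)} ≤ ENNReal.ofReal ((K * t) ^ (d - 1))) :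
    ∫⁻ ω, ENNReal.ofReal (Real.sqrt ((t * Real.sqrt d) ^ 2 - Z ω ^ 2)) ∂μ ≤
      ENNReal.ofReal ((K * t) ^ (d - 1) * (4 * t)) := by
  have hd' : 0 < d - 1 := by linarith
  have hsd : 0 < Real.sqrt (d - 1) := Real.sqrt_pos.2 hd'
  have hs2 : (t * Real.sqrt d) ^ 2 = t ^ 2 * d := by
    rw [mul_pow, Real.sq_sqrt (by linarith)]
  have hb : 0 < 1 / (2 * t ^ 2) := by positivity
  set A : ℝ := (K * t) ^ (d - 1) * Real.exp (1 / 2) with hA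
  have hA0 : 0 ≤ A := by positivity
  rw [lintegral_eq_lintegral_meas_le μ (Filter.Eventually.of_forall fun ω => Real.sqrt_nonneg _)
    (by fun_prop)]
  have hpt : ∀ u ∈ Set.Ioi (0 : ℝ),
      μ {ω | u ≤ Real.sqrt ((t * Real.sqrt d) ^ 2 - Z ω ^ 2)} ≤
        ENNReal.ofReal (A * Real.exp (-(1 / (2 * t ^ 2)) * u ^ 2)) := by
    intro u hu
    have hu' : 0 < u := hu
    have hmem : ∀ ω, u ≤ Real.sqrt ((t * Real.sqrt d) ^ 2 - Z ω ^ 2) →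
        Z ω ^ 2 ≤ t ^ 2 * d - u ^ 2 := by
      intro ω hω
      have := (Real.le_sqrt' hu').1 hω
      linarith
    by_cases hw : u ^ 2 / t ^ 2 ≤ d
    · set τ : ℝ := t * (Real.sqrt (d - u ^ 2 / t ^ 2) / Real.sqrt (d - 1)) with hτ
      refine (measure_mono fun ω hω => ?_).trans ((h τ (by positivity)).trans ?_)
      · have h1 : τ * Real.sqrt (d - 1) = t * Real.sqrt (d - u ^ 2 / t ^ 2) := by
          rw [hτ]; field_simp
        change Z ω ≤ τ * Real.sqrt (d - 1)
        rw [h1]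
        refine le_of_sq_le_sq ?_ (by positivity)
        rw [mul_pow, Real.sq_sqrt (by linarith)]
        refine (hmem ω hω).trans_eq ?_
        field_simp
      · refine ENNReal.ofReal_le_ofReal ?_
        rw [hτ, ← mul_assoc, Real.mul_rpow (by positivity) (by positivity), hA, mul_assoc,
          ← Real.exp_add]
        refine mul_le_mul_of_nonneg_left ?_ (by positivity)
        refine (rpow_sqrt_div_sqrt_le_exp hd hw).trans_eq ?_
        congr 1
        field_simp
        ring
    · have hempty : {ω | u ≤ Real.sqrt ((t * Real.sqrt d) ^ 2 - Z ω ^ 2)} = ∅ := by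
        refine Set.eq_empty_of_forall_notMem fun ω hω => hw ?_
        rw [div_le_iff₀ (by positivity)]
        nlinarith [hmem ω hω, sq_nonneg (Z ω)]
      rw [hempty, measure_empty]
      exact zero_le
  refine (setLIntegral_mono' measurableSet_Ioi hpt).trans ?_
  rw [← ofReal_integral_eq_lintegral_ofReal
    ((integrable_exp_neg_mul_sq hb).const_mul A).integrableOn
    (Filter.Eventually.of_forall fun u => by positivity), integral_const_mul,
    integral_gaussian_Ioi]
  refine ENNReal.ofReal_le_ofReal ?_
  rw [hA, mul_assoc]
  refine mul_le_mul_of_nonneg_left ?_ (by positivity)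
  have h1 : Real.exp (1 / 2) ≤ 2 := by
    have h2 : Real.exp (1 / 2) ^ 2 = Real.exp 1 := by
      rw [← Real.exp_nat_mul]; norm_num
    nlinarith [Real.exp_one_lt_d9, Real.exp_pos (1 / 2 : ℝ)]
  have h3 : Real.sqrt (Real.pi / (1 / (2 * t ^ 2))) / 2 ≤ 2 * t := by
    have : Real.sqrt (Real.pi / (1 / (2 * t ^ 2))) ≤ 4 * t := by
      refine Real.sqrt_le_iff.2 ⟨by positivity, ?_⟩
      rw [div_div_eq_mul_div, div_one]
      nlinarith [Real.pi_le_four, sq_nonneg t]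
    linarith
  calc _ ≤ 2 * (2 * t) := mul_le_mul h1 h3 (by positivity) (by norm_num)
    _ = 4 * t := by ring

/-- **Tensorization of small ball probabilities, continued.** If `ℙ(Z₁ ≤ t | Z₂) ≤ K₁ t`
almost surely, `ℙ(Z₂ ≤ t√(d-1)) ≤ (K₂ t)^{d-1}` for all `t ≥ 0`, and `K₁ ≤ c K₂`, then
`ℙ(√(Z₁² + Z₂²) ≤ t√d) ≤ (K₂ t)^d` for all `t ≥ 0`. -/
theorem small_ball_tensorization_continued :
    ∃ c : ℝ, 0 < c ∧
      ∀ (Ω : Type) [MeasureSpace Ω], ∀ (_ : IsProbabilityMeasure (ℙ : Measure Ω))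
        (Z₁ Z₂ : Ω → ℝ), Measurable Z₁ → Measurable Z₂ →
        (∀ ω, 0 ≤ Z₁ ω) → (∀ ω, 0 ≤ Z₂ ω) →
        ∀ (K₁ K₂ d : ℝ), 0 ≤ K₁ → 0 ≤ K₂ → 1 < d →
        (∀ t : ℝ, 0 ≤ t → ∀ᵐ ω ∂ℙ,
          (ℙ⟦{ω' | Z₁ ω' ≤ t} | MeasurableSpace.comap Z₂ inferInstance⟧) ω ≤ K₁ * t) →
        (∀ t : ℝ, 0 ≤ t →
          ℙ {ω | Z₂ ω ≤ t * Real.sqrt (d - 1)} ≤ ENNReal.ofReal ((K₂ * t) ^ (d - 1))) →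
        K₁ ≤ c * K₂ →
        ∀ t : ℝ, 0 ≤ t →
          ℙ {ω | Real.sqrt (Z₁ ω ^ 2 + Z₂ ω ^ 2) ≤ t * Real.sqrt d}
            ≤ ENNReal.ofReal ((K₂ * t) ^ d) := by
  refine ⟨1 / 4, by norm_num, ?_⟩
  intro Ω _ _ Z₁ Z₂ hZ₁ hZ₂ _ _ K₁ K₂ d hK₁ hK₂ hd h₁ h₂ hK t ht
  rcases ht.eq_or_lt with rfl | ht
  · have h0 := h₂ 0 le_rfl
    rw [mul_zero, Real.zero_rpow (by linarith)] at h0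
    rw [mul_zero, Real.zero_rpow (by linarith)]
    refine (measure_mono fun ω hω => ?_).trans h0
    have hω' : Real.sqrt (Z₁ ω ^ 2 + Z₂ ω ^ 2) ≤ 0 * Real.sqrt d := hω
    change Z₂ ω ≤ 0 * Real.sqrt (d - 1)
    rw [zero_mul] at hω' ⊢
    exact (Real.le_sqrt_of_sq_le (by nlinarith [sq_nonneg (Z₁ ω)])).trans hω'
  · refine (measure_sqrt_sq_add_sq_le hZ₁ hZ₂ hK₁ h₁ (by positivity)).trans ?_
    refine (mul_le_mul_right (lintegral_sqrt_sub_sq_le hZ₂ hK₂ hd ht h₂) _).trans ?_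
    rw [← ENNReal.ofReal_mul hK₁]
    refine ENNReal.ofReal_le_ofReal ?_
    have hpow : (K₂ * t) ^ d = (K₂ * t) ^ (d - 1) * (K₂ * t) := by
      rw [← Real.rpow_add_one' (by positivity) (by linarith), sub_add_cancel]
    rw [hpow, mul_left_comm]
    exact mul_le_mul_of_nonneg_left (by nlinarith) (by positivity)
end
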